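/- arXiv:2006.16376 — 3 statements merged into one kernel-verified Lean document; each statement's English description precedes it below -/
import Mathlib

section
/- Let δ, C₁, C₂ > 0 be constants, let (ω_k)_{k≥1} be a sequence of positive step sizes with ω_k → 0 and liminf_{k→∞} ( 2δ·ω_k/ω_{k+1} + (ω_{k+1} − ω_k)/ω_{k+1}² ) > 0, and let (Δ_k)_{k≥1} be a nonnegative bounded real sequence. Then there exist λ₀ > 0 and an index k₀ such that for every λ ≥ λ₀ and every k ≥ k₀, the sequence ψ_k := λ·ω_k + (2C₂/δ)·sup_{i≥k₀} Δ_i satisfies ψ_{k+1} ≥ (1 − 2δ·ω_{k+1} + C₁·ω_{k+1}²)·ψ_k + C₁·ω_{k+1}² + 2C₂·Δ_k·ω_{k+1}. -/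
open Filter

/-- A real function with positive `liminf` is eventually bounded below by a positive constant. -/
theorem exists_pos_eventually_le_of_liminf_pos {α : Type*} {l : Filter α} {f : α → ℝ}
    (h : 0 < liminf f l) : ∃ a, 0 < a ∧ ∀ᶠ x in l, a ≤ f x := by
  rw [liminf_eq] at h
  have hne : {a | ∀ᶠ x in l, a ≤ f x}.Nonempty := by
    by_contra hempty
    rw [Set.not_nonempty_iff_eq_empty.1 hempty, Real.sSup_empty] at h
    exact h.false
  obtain ⟨a, hmem, ha⟩ := exists_lt_of_lt_csSup hne h
  exact ⟨a, ha, hmem⟩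

/-- Sequence lemma (Lemma 1 of the appendix). -/
theorem stmt_0
    (δ C₁ C₂ : ℝ) (hδ : 0 < δ) (hC₁ : 0 < C₁) (hC₂ : 0 < C₂)
    (ω : ℕ → ℝ) (hω : ∀ k, 1 ≤ k → 0 < ω k)
    (hω0 : Tendsto ω atTop (nhds 0))
    (hliminf : 0 < Filter.liminf
      (fun k => 2 * δ * ω k / ω (k + 1) + (ω (k + 1) - ω k) / (ω (k + 1)) ^ 2) atTop)
    (Δ : ℕ → ℝ) (hΔ : ∀ k, 1 ≤ k → 0 ≤ Δ k)
    (hΔbdd : ∃ B : ℝ, ∀ k, 1 ≤ k → Δ k ≤ B) :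
    ∃ lam₀ : ℝ, 0 < lam₀ ∧ ∃ k₀ : ℕ, 1 ≤ k₀ ∧
      ∀ lam : ℝ, lam₀ ≤ lam → ∀ k : ℕ, k₀ ≤ k →
        (fun j => lam * ω j + (2 * C₂ / δ) * sSup (Δ '' Set.Ici k₀)) (k + 1) ≥
          (1 - 2 * δ * ω (k + 1) + C₁ * (ω (k + 1)) ^ 2) *
              (fun j => lam * ω j + (2 * C₂ / δ) * sSup (Δ '' Set.Ici k₀)) k
            + C₁ * (ω (k + 1)) ^ 2 + 2 * C₂ * Δ k * ω (k + 1) := by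
  obtain ⟨a, ha, haf⟩ := exists_pos_eventually_le_of_liminf_pos hliminf
  obtain ⟨B, hB⟩ := hΔbdd
  have hw : ∀ᶠ k in atTop, ω k < min (a / (2 * C₁)) (δ / C₁) :=
    hω0.eventually_lt_const (by positivity)
  obtain ⟨N, hN⟩ := eventually_atTop.1 (haf.and hw)
  refine ⟨2 * C₁ / a, by positivity, max N 1, le_max_right _ _, fun lam hlam k hk => ?_⟩
  have hNk : N ≤ k := (le_max_left _ _).trans hk
  have h1k : 1 ≤ k := (le_max_right _ _).trans hk
  have hbdd : BddAbove (Δ '' Set.Ici (max N 1)) := by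
    refine ⟨B, ?_⟩
    rintro _ ⟨j, hj, rfl⟩
    exact hB j ((le_max_right _ _).trans hj)
  have hΔS : Δ k ≤ sSup (Δ '' Set.Ici (max N 1)) := le_csSup hbdd ⟨k, hk, rfl⟩
  have hf := (hN k hNk).1
  have hwk : ω k * (2 * C₁) < a :=
    (lt_div_iff₀ (by positivity)).1 ((hN k hNk).2.trans_le (min_le_left _ _))
  have hvk : ω (k + 1) * C₁ < δ :=
    (lt_div_iff₀ hC₁).1 ((hN (k + 1) (by omega)).2.trans_le (min_le_right _ _))
  have hv := hω (k + 1) (by omega)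
  have hΔk := hΔ k h1k
  have hlam' : 2 * C₁ ≤ lam * a := (div_le_iff₀ ha).1 hlam
  have hlam0 : 0 < lam := lt_of_lt_of_le (by positivity) hlam
  beta_reduce
  generalize sSup (Δ '' Set.Ici (max N 1)) = S at *
  generalize ω k = w at *
  generalize ω (k + 1) = v at *
  have hstep : C₁ * v ^ 2 ≤ lam * (v - w + 2 * δ * v * w - C₁ * v ^ 2 * w) := by
    have hfactor : lam * (v - w + 2 * δ * v * w - C₁ * v ^ 2 * w)
        = v ^ 2 * (lam * (2 * δ * w / v + (v - w) / v ^ 2 - C₁ * w)) := by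
      field_simp
      ring
    have hhalf : lam * (a / 2) ≤ lam * (2 * δ * w / v + (v - w) / v ^ 2 - C₁ * w) :=
      mul_le_mul_of_nonneg_left (by linarith) hlam0.le
    rw [hfactor, mul_comm C₁]
    exact mul_le_mul_of_nonneg_left (by linarith) (by positivity)
  have hnoise : 2 * C₂ * Δ k * v ≤ 2 * C₂ / δ * S * (2 * δ * v - C₁ * v ^ 2) := by
    have hS : 0 ≤ S := hΔk.trans hΔS
    calc 2 * C₂ * Δ k * v ≤ 2 * C₂ * S * v := by gcongr
      _ = 2 * C₂ / δ * S * (δ * v) := by field_simp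
      _ ≤ 2 * C₂ / δ * S * (2 * δ * v - C₁ * v ^ 2) :=
        mul_le_mul_of_nonneg_left (by nlinarith) (by positivity)
  linarith
end

section
/- Let δ, C₁, C₂, C₃ > 0, let (ω_k) be a sequence of positive reals with ω_k → 0, liminf_{k→∞} ( 2δ·ω_k/ω_{k+1} + (ω_{k+1} − ω_k)/ω_{k+1}² ) > 0, 1 − 2δω_k + C₁ω_k² ≥ 0 for all k, and (ω_{k+1} − ω_k)/(ω_k·ω_{k+1}) + 2δ − C₁·ω_{k+1} ≥ 0 for all sufficiently large k. Let (Δ_k) be a nonnegative bounded sequence, let (z_k) be a real sequence with |z_k| ≤ C₃ for all k, and let (e_k) be a nonnegative real sequence satisfying e_{k+1} ≤ (1 − 2δω_{k+1} + C₁ω_{k+1}²)·e_k + C₁ω_{k+1}² + 2C₂·Δ_k·ω_{k+1} + 2ω_{k+1}·(z_k − z_{k+1}) for all k. Then there exist a constant λ > 0 and an index k₀ such that e_k ≤ λ·ω_k + (2C₂/δ)·sup_{i≥k₀} Δ_i for all k ≥ k₀. -/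
open Filter

/-- A positive real `liminf` yields a positive eventual lower bound, with no boundedness assumption. -/
theorem exists_pos_eventually_le_of_liminf_pos_s8 {u : ℕ → ℝ} (h : 0 < liminf u atTop) :
    ∃ a : ℝ, 0 < a ∧ ∀ᶠ k in atTop, a ≤ u k := by
  rw [liminf_eq] at h
  have hne : {a : ℝ | ∀ᶠ k in atTop, a ≤ u k}.Nonempty := by
    by_contra hemp
    rw [Set.not_nonempty_iff_eq_empty] at hemp
    rw [hemp, Real.sSup_empty] at h
    exact h.false
  obtain ⟨a, ha, hpos⟩ := exists_lt_of_lt_csSup hne h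
  exact ⟨a, hpos, ha⟩

/-- The quadratic gap between the new step size `w'` and the contracted old step size `w`. -/
theorem half_mul_sq_le_sub_contraction_mul {δ C₁ a w w' : ℝ} (hw' : 0 < w')
    (ha : a ≤ 2 * δ * w / w' + (w' - w) / w' ^ 2) (hsmall : C₁ * w ≤ a / 2) :
    a / 2 * w' ^ 2 ≤ w' - (1 - 2 * δ * w' + C₁ * w' ^ 2) * w := by
  have hgap : a * w' ^ 2 ≤ 2 * δ * w * w' + (w' - w) := by
    have h := mul_le_mul_of_nonneg_right ha (sq_nonneg w')
    have heq : (2 * δ * w / w' + (w' - w) / w' ^ 2) * w' ^ 2 = 2 * δ * w * w' + (w' - w) := by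
      field_simp
    rwa [heq] at h
  have h := mul_le_mul_of_nonneg_right hsmall (sq_nonneg w')
  linarith

/-- Deterministic core of the appendix convergence theorem (Theorem 1). -/
theorem stmt_8
    (δ C₁ C₂ C₃ : ℝ) (hδ : 0 < δ) (hC₁ : 0 < C₁) (hC₂ : 0 < C₂) (hC₃ : 0 < C₃)
    (ω : ℕ → ℝ) (hωpos : ∀ k, 0 < ω k)
    (hω0 : Tendsto ω atTop (nhds 0))
    (hliminf : 0 < Filter.liminf
      (fun k => 2 * δ * ω k / ω (k + 1) + (ω (k + 1) - ω k) / (ω (k + 1)) ^ 2) atTop)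
    (hcontr : ∀ k, 0 ≤ 1 - 2 * δ * ω k + C₁ * (ω k) ^ 2)
    (hstep : ∃ N : ℕ, ∀ k, N ≤ k →
      (ω (k + 1) - ω k) / (ω k * ω (k + 1)) + 2 * δ - C₁ * ω (k + 1) ≥ 0)
    (Δ : ℕ → ℝ) (hΔ : ∀ k, 0 ≤ Δ k) (hΔbdd : ∃ B : ℝ, ∀ k, Δ k ≤ B)
    (z : ℕ → ℝ) (hz : ∀ k, |z k| ≤ C₃)
    (e : ℕ → ℝ) (he0 : ∀ k, 0 ≤ e k)
    (he : ∀ k, e (k + 1) ≤ (1 - 2 * δ * ω (k + 1) + C₁ * (ω (k + 1)) ^ 2) * e k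
      + C₁ * (ω (k + 1)) ^ 2 + 2 * C₂ * Δ k * ω (k + 1)
      + 2 * ω (k + 1) * (z k - z (k + 1))) :
    ∃ lam : ℝ, 0 < lam ∧ ∃ k₀ : ℕ, ∀ k, k₀ ≤ k →
      e k ≤ lam * ω k + (2 * C₂ / δ) * sSup (Δ '' Set.Ici k₀) := by
  obtain ⟨a, ha, hev⟩ := exists_pos_eventually_le_of_liminf_pos_s8 hliminf
  have hε : 0 < min (a / 2 / C₁) (δ / C₁) := by positivity
  obtain ⟨k₀, hk₀⟩ := eventually_atTop.1 (hev.and (hω0.eventually_lt_const hε))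
  have hgap : ∀ k, k₀ ≤ k → a / 2 * ω (k + 1) ^ 2 ≤
      ω (k + 1) - (1 - 2 * δ * ω (k + 1) + C₁ * ω (k + 1) ^ 2) * ω k := by
    intro k hk
    refine half_mul_sq_le_sub_contraction_mul (hωpos _) (hk₀ k hk).1 ?_
    have h := ((hk₀ k hk).2.trans_le (min_le_left _ _)).le
    rw [le_div_iff₀ hC₁] at h
    linarith
  have hsmall : ∀ k, k₀ ≤ k → C₁ * ω k ≤ δ := by
    intro k hk
    have h := ((hk₀ k hk).2.trans_le (min_le_right _ _)).le
    rw [le_div_iff₀ hC₁] at h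
    linarith
  set S := sSup (Δ '' Set.Ici k₀)
  have hΔS : ∀ k, k₀ ≤ k → Δ k ≤ S := by
    intro k hk
    obtain ⟨B, hB⟩ := hΔbdd
    refine le_csSup ⟨B, ?_⟩ ⟨k, hk, rfl⟩
    rintro _ ⟨i, -, rfl⟩
    exact hB i
  have hS0 : 0 ≤ S := (hΔ k₀).trans (hΔS k₀ le_rfl)
  set D := 2 * C₂ / δ
  have hD0 : 0 < D := by positivity
  have hDδ : D * δ = 2 * C₂ := div_mul_cancel₀ _ hδ.ne'
  set L := 2 * C₁ / a + e k₀ / ω k₀ with hL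
  have he₀ : 0 ≤ e k₀ / ω k₀ := div_nonneg (he0 _) (hωpos _).le
  have hL0 : 0 < L := by positivity
  have hLa : C₁ ≤ L * (a / 2) := by
    have h : L * (a / 2) = C₁ + e k₀ / ω k₀ * (a / 2) := by
      rw [hL]; field_simp
    rw [h]
    have : 0 ≤ e k₀ / ω k₀ * (a / 2) := by positivity
    linarith
  -- Absorbing the telescoping term leaves a recursion driven only by `ω` and `Δ`.
  have key : ∀ k, k₀ ≤ k → e k + 2 * ω k * (z k - C₃) ≤ L * ω k + D * S := by
    intro k hk
    induction k, hk using Nat.le_induction with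
    | base =>
      have h₁ : e k₀ / ω k₀ * ω k₀ = e k₀ := div_mul_cancel₀ _ (hωpos _).ne'
      have h₂ : 0 ≤ 2 * C₁ / a * ω k₀ := mul_nonneg (by positivity) (hωpos _).le
      have h₃ : 0 ≤ ω k₀ * (C₃ - z k₀) :=
        mul_nonneg (hωpos _).le (sub_nonneg.2 ((le_abs_self _).trans (hz _)))
      have h₄ : 0 ≤ D * S := by positivity
      rw [hL, add_mul, h₁]
      linarith
    | succ k hk ih =>
      have hrec := he k
      have hA := hcontr (k + 1)
      have hg := hgap k hk
      have hs := hsmall (k + 1) (by omega)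
      have hw := hωpos (k + 1)
      generalize hAdef : 1 - 2 * δ * ω (k + 1) + C₁ * ω (k + 1) ^ 2 = A at hrec hA hg
      have hg0 : 0 ≤ ω (k + 1) - A * ω k := le_trans (by positivity) hg
      have hzg : 0 ≤ (C₃ - z k) * (ω (k + 1) - A * ω k) :=
        mul_nonneg (sub_nonneg.2 ((le_abs_self _).trans (hz _))) hg0
      have hih := mul_le_mul_of_nonneg_left ih hA
      have hLg := mul_le_mul_of_nonneg_left hg hL0.le
      have hLaw := mul_le_mul_of_nonneg_right hLa (sq_nonneg (ω (k + 1)))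
      have hΔw : 2 * C₂ * Δ k * ω (k + 1) ≤ D * δ * S * ω (k + 1) := by
        rw [hDδ]
        have := hΔS k hk
        gcongr
      have hAS : A * (D * S) + D * δ * S * ω (k + 1) ≤ D * S := by
        have h := mul_le_mul_of_nonneg_left hs
          (mul_nonneg (mul_nonneg hD0.le hS0) hw.le)
        rw [← hAdef]
        linarith
      linarith
  refine ⟨L + 4 * C₃, by positivity, k₀, fun k hk => ?_⟩
  have h := mul_le_mul_of_nonneg_left (neg_le_of_abs_le (hz k)) (hωpos k).le
  have := key k hk
  linarith
end

section
/- Let δ, C₁, C₂ > 0, let c₁, c₂ > 0 and γ ∈ (1/2, 1), define ω_k := c₁·(k + c₂)^{−γ} for k ≥ 1, and let (Δ_k)_{k≥1} be a nonnegative bounded real sequence. Then there exist λ₀ > 0 and an index k₀ such that for every λ ≥ λ₀ and every k ≥ k₀, the sequence ψ_k := λ·ω_k + (2C₂/δ)·sup_{i≥k₀} Δ_i satisfies ψ_{k+1} ≥ (1 − 2δ·ω_{k+1} + C₁·ω_{k+1}²)·ψ_k + C₁·ω_{k+1}² + 2C₂·Δ_k·ω_{k+1}. -/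
open Filter Topology

/-- Concavity of `x ↦ x ^ γ` bounds its unit increments. -/
theorem rpow_add_one_sub_rpow_le {x γ : ℝ} (hx : 0 < x) (hγ0 : 0 ≤ γ) (hγ1 : γ ≤ 1) :
    (x + 1) ^ γ - x ^ γ ≤ γ * x ^ (-(1 - γ)) := by
  have hinv : 0 < x⁻¹ := inv_pos.mpr hx
  have hfac : x + 1 = x * (1 + x⁻¹) := by field_simp
  have hbern := rpow_one_add_le_one_add_mul_self (s := x⁻¹) (by linarith) hγ0 hγ1
  have hpow : x ^ (-(1 - γ)) = x ^ γ * x⁻¹ := by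
    rw [show -(1 - γ) = γ - 1 by ring, Real.rpow_sub_one hx.ne', div_eq_mul_inv]
  rw [hfac, Real.mul_rpow hx.le (by positivity), hpow]
  nlinarith [mul_le_mul_of_nonneg_left hbern (Real.rpow_nonneg hx.le γ)]

/-- Consecutive differences of `c * x ^ (-γ)`, `γ < 1`, are negligible against the product of
consecutive values. -/
theorem eventually_rpow_step_sub_le {c γ ε : ℝ} (hc : 0 < c) (hγ0 : 0 ≤ γ) (hγ1 : γ < 1)
    (hε : 0 < ε) :
    ∀ᶠ x : ℝ in atTop, c * x ^ (-γ) - c * (x + 1) ^ (-γ) ≤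
      ε * (c * x ^ (-γ)) * (c * (x + 1) ^ (-γ)) := by
  have hlim : Tendsto (fun x : ℝ => γ * x ^ (-(1 - γ))) atTop (𝓝 0) := by
    simpa using (tendsto_rpow_neg_atTop (sub_pos.mpr hγ1)).const_mul γ
  filter_upwards [hlim.eventually_le_const (mul_pos hε hc), eventually_gt_atTop 0]
    with x hx hx0
  have hP : 0 < x ^ γ := Real.rpow_pos_of_pos hx0 γ
  have hQ : 0 < (x + 1) ^ γ := Real.rpow_pos_of_pos (by linarith) γ
  have hPQ := (rpow_add_one_sub_rpow_le hx0 hγ0 hγ1.le).trans hx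
  rw [Real.rpow_neg hx0.le, Real.rpow_neg (by linarith : (0 : ℝ) ≤ x + 1)]
  calc c * (x ^ γ)⁻¹ - c * ((x + 1) ^ γ)⁻¹
      = ((x + 1) ^ γ - x ^ γ) * (c * (x ^ γ)⁻¹ * ((x + 1) ^ γ)⁻¹) := by field_simp
    _ ≤ (ε * c) * (c * (x ^ γ)⁻¹ * ((x + 1) ^ γ)⁻¹) := by gcongr
    _ = _ := by ring

/-- One step of the recursion, for consecutive step sizes `a` and `b`. -/
theorem step_recursion_le {δ C₁ C₂ a b lam S D : ℝ} (hδ : 0 < δ) (hC₁ : 0 < C₁) (hC₂ : 0 < C₂)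
    (hb : 0 < b) (hba : b ≤ a) (hsmall : C₁ * b ≤ δ) (hdiff : a - b ≤ δ / 2 * a * b)
    (hlam : 2 * C₁ / δ ≤ lam) (hS : 0 ≤ S) (hD : D ≤ S) :
    (1 - 2 * δ * b + C₁ * b ^ 2) * (lam * a + 2 * C₂ / δ * S) + C₁ * b ^ 2 + 2 * C₂ * D * b ≤
      lam * b + 2 * C₂ / δ * S := by
  obtain ⟨M, hM⟩ : ∃ M, M = 2 * C₂ / δ * S := ⟨_, rfl⟩
  have hM0 : 0 ≤ M := hM ▸ by positivity
  have hMS : δ * M = 2 * C₂ * S := by rw [hM]; field_simp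
  rw [← hM]
  have ha : 0 < a := hb.trans_le hba
  have hlam0 : 0 < lam := lt_of_lt_of_le (by positivity) hlam
  have hlam' : 2 * C₁ ≤ lam * δ := (div_le_iff₀ hδ).mp hlam
  have hgain : δ / 2 * b ^ 2 ≤ b - a + 2 * δ * a * b - C₁ * b ^ 2 * a := by
    nlinarith [mul_le_mul_of_nonneg_right hsmall (mul_pos ha hb).le,
      mul_le_mul_of_nonneg_left hba (mul_pos hδ hb).le]
  have hgain_lam := mul_le_mul_of_nonneg_left hgain hlam0.le
  have hC₁b : 2 * C₁ * b ^ 2 ≤ lam * δ * b ^ 2 := by gcongr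
  have hDS : 2 * C₂ * b * D ≤ 2 * C₂ * b * S := by gcongr
  have hMb : C₁ * b * (M * b) ≤ δ * (M * b) := by gcongr
  have hMSb : δ * M * b = 2 * C₂ * S * b := by rw [hMS]
  linarith

/-- Instantiation of the sequence lemma for the concrete polynomially decaying
step sizes `ω_k = c₁(k + c₂)^{-γ}`. -/
theorem stmt_16
    (δ C₁ C₂ : ℝ) (hδ : 0 < δ) (hC₁ : 0 < C₁) (hC₂ : 0 < C₂)
    (c₁ c₂ γ : ℝ) (hc₁ : 0 < c₁) (hc₂ : 0 < c₂)
    (hγ : γ ∈ Set.Ioo (1 / 2 : ℝ) 1)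
    (ω : ℕ → ℝ)
    (hω : ∀ k, 1 ≤ k → ω k = c₁ * ((k : ℝ) + c₂) ^ (-γ))
    (Δ : ℕ → ℝ) (hΔ : ∀ k, 1 ≤ k → 0 ≤ Δ k)
    (hΔbdd : ∃ B : ℝ, ∀ k, 1 ≤ k → Δ k ≤ B) :
    ∃ lam₀ : ℝ, 0 < lam₀ ∧ ∃ k₀ : ℕ, 1 ≤ k₀ ∧
      ∀ lam : ℝ, lam₀ ≤ lam → ∀ k : ℕ, k₀ ≤ k →
        (fun j => lam * ω j + (2 * C₂ / δ) * sSup (Δ '' Set.Ici k₀)) (k + 1) ≥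
          (1 - 2 * δ * ω (k + 1) + C₁ * (ω (k + 1)) ^ 2) *
              (fun j => lam * ω j + (2 * C₂ / δ) * sSup (Δ '' Set.Ici k₀)) k
            + C₁ * (ω (k + 1)) ^ 2 + 2 * C₂ * Δ k * ω (k + 1) := by
  obtain ⟨hγl, hγ1⟩ := hγ
  have hγ0 : 0 < γ := by linarith
  have hx : Tendsto (fun k : ℕ => (k : ℝ) + c₂) atTop atTop :=
    tendsto_atTop_add_const_right _ _ tendsto_natCast_atTop_atTop
  have hlim : Tendsto (fun x : ℝ => C₁ * (c₁ * x ^ (-γ))) atTop (𝓝 0) := by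
    simpa using ((tendsto_rpow_neg_atTop hγ0).const_mul c₁).const_mul C₁
  obtain ⟨N, hN⟩ := eventually_atTop.mp
    ((hx.eventually (hlim.eventually_le_const hδ)).and
      (hx.eventually (eventually_rpow_step_sub_le hc₁ hγ0.le hγ1 (half_pos hδ))))
  refine ⟨2 * C₁ / δ, by positivity, max N 1, le_max_right _ _, fun lam hlam k hk => ?_⟩
  have hk1 : 1 ≤ k := (le_max_right _ _).trans hk
  have hxk : 0 < (k : ℝ) + c₂ := by positivity
  have hωk : ω k = c₁ * ((k : ℝ) + c₂) ^ (-γ) := hω k hk1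
  have hωk' : ω (k + 1) = c₁ * ((k : ℝ) + c₂ + 1) ^ (-γ) := by
    rw [hω (k + 1) (by omega)]
    push_cast
    ring_nf
  obtain ⟨hsmall, hdiff⟩ := hN k ((le_max_left _ _).trans hk)
  rw [← hωk] at hsmall
  rw [← hωk, ← hωk'] at hdiff
  have hpos : 0 < ω (k + 1) := hωk' ▸ by positivity
  have hanti : ω (k + 1) ≤ ω k := by
    rw [hωk, hωk']
    exact mul_le_mul_of_nonneg_left
      (Real.rpow_le_rpow_of_nonpos hxk (by linarith) (by linarith)) hc₁.le
  obtain ⟨B, hB⟩ := hΔbdd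
  have hbdd : BddAbove (Δ '' Set.Ici (max N 1)) := by
    refine ⟨B, ?_⟩
    rintro _ ⟨i, hi, rfl⟩
    exact hB i ((le_max_right _ _).trans hi)
  have hD : Δ k ≤ sSup (Δ '' Set.Ici (max N 1)) := le_csSup hbdd ⟨k, hk, rfl⟩
  exact step_recursion_le hδ hC₁ hC₂ hpos hanti
    ((mul_le_mul_of_nonneg_left hanti hC₁.le).trans hsmall) hdiff hlam ((hΔ k hk1).trans hD) hD
end
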